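/- Let K be a field of characteristic zero and let F be a five-dimensional invariant subspace of K[Σ₃] not containing W = Id + τ₁₂ + τ₁₃ + τ₂₃ + c₁ + c₂. Then F = { (a₁,a₂,a₃,a₄,a₅,a₆) ∈ K[Σ₃] : a₁ + a₂ + a₃ + a₄ + a₅ + a₆ = 0 }, and F = F_v for v = (2,−1,−1,−1,1,0) = 2·Id − τ₁₂ − τ₁₃ − τ₂₃ + c₁. -/

import Mathlib

open scoped TensorProduct

abbrev S3 := Equiv.Perm (Fin 3)

def t12 : S3 := Equiv.swap 0 1
def t13 : S3 := Equiv.swap 0 2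
def t23 : S3 := Equiv.swap 1 2
def c1 : S3 := Equiv.swap 0 2 * Equiv.swap 0 1
def c2 : S3 := c1 * c1

abbrev GA (K : Type*) [Field K] := S3 → K

def act {K : Type*} [Field K] (σ : S3) (v : GA K) : GA K := fun τ => v (σ * τ)

def Fv (K : Type*) [Field K] (v : GA K) : Submodule K (GA K) :=
  Submodule.span K (Set.range fun σ => act σ v)

def elt {K : Type*} [Field K] (a₁ a₂ a₃ a₄ a₅ a₆ : K) : GA K := fun σ =>
  (if σ = 1 then a₁ else 0) + (if σ = t12 then a₂ else 0) + (if σ = t13 then a₃ else 0) +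
  (if σ = t23 then a₄ else 0) + (if σ = c1 then a₅ else 0) + (if σ = c2 then a₆ else 0)

def Vv (K : Type*) [Field K] : GA K := elt 1 (-1) (-1) (-1) 1 1
def Wv (K : Type*) [Field K] : GA K := elt 1 1 1 1 1 1

def assoc {K A : Type*} [Field K] [AddCommGroup A] [Module K A]
    (μ : A →ₗ[K] A →ₗ[K] A) (x y z : A) : A := μ (μ x y) z - μ x (μ y z)

def bra {K A : Type*} [Field K] [AddCommGroup A] [Module K A]
    (μ : A →ₗ[K] A →ₗ[K] A) (x y : A) : A := μ x y - μ y x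

def LieAdmissible {K A : Type*} [Field K] [AddCommGroup A] [Module K A]
    (μ : A →ₗ[K] A →ₗ[K] A) : Prop :=
  ∀ x y z : A, bra μ x (bra μ y z) + bra μ y (bra μ z x) + bra μ z (bra μ x y) = 0

def Lterm {K A : Type*} [Field K] [AddCommGroup A] [Module K A]
    (μ : A →ₗ[K] A →ₗ[K] A) (σ : S3) (x : Fin 3 → A) : A :=
  μ (μ (x (σ⁻¹ 0)) (x (σ⁻¹ 1))) (x (σ⁻¹ 2))

def Rterm {K A : Type*} [Field K] [AddCommGroup A] [Module K A]
    (μ : A →ₗ[K] A →ₗ[K] A) (σ : S3) (x : Fin 3 → A) : A :=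
  μ (x (σ⁻¹ 0)) (μ (x (σ⁻¹ 1)) (x (σ⁻¹ 2)))

def assocPhi {K A : Type*} [Field K] [AddCommGroup A] [Module K A]
    (μ : A →ₗ[K] A →ₗ[K] A) (v : GA K) : Prop :=
  ∀ x : Fin 3 → A, ∑ σ : S3, v σ • assoc μ (x (σ⁻¹ 0)) (x (σ⁻¹ 1)) (x (σ⁻¹ 2)) = 0

lemma sum_S3 {M : Type*} [AddCommMonoid M] (f : S3 → M) :
    ∑ σ, f σ = f 1 + f t12 + f t13 + f t23 + f c1 + f c2 := by
  have h : (Finset.univ : Finset S3) = {1, t12, t13, t23, c1, c2} := by decide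
  rw [h, Finset.sum_insert (by decide), Finset.sum_insert (by decide),
    Finset.sum_insert (by decide), Finset.sum_insert (by decide),
    Finset.sum_insert (by decide), Finset.sum_singleton]
  simp only [add_assoc]

lemma S3_cases (σ : S3) :
    σ = 1 ∨ σ = t12 ∨ σ = t13 ∨ σ = t23 ∨ σ = c1 ∨ σ = c2 := by
  revert σ
  decide

section Augmentation

variable {K : Type*} [Field K]

lemma Wv_apply (τ : S3) : Wv K τ = 1 := by
  rcases S3_cases τ with rfl | rfl | rfl | rfl | rfl | rfl <;> simp +decide [Wv, elt]

lemma sum_act (x : GA K) : ∑ σ, act σ x = (∑ σ, x σ) • Wv K := by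
  funext τ
  simp only [Finset.sum_apply, Pi.smul_apply, Wv_apply, smul_eq_mul, mul_one, act]
  exact Equiv.sum_comp (Equiv.mulRight τ) x

/-- The sum of the coefficients, as a linear form on the group algebra. -/
def augmentation (K : Type*) [Field K] : GA K →ₗ[K] K := ∑ σ, LinearMap.proj σ

lemma augmentation_apply (x : GA K) : augmentation K x = ∑ σ, x σ := by
  simp [augmentation]

lemma augmentation_act (σ : S3) (x : GA K) : augmentation K (act σ x) = augmentation K x := by
  simp only [augmentation_apply, act]
  exact Equiv.sum_comp (Equiv.mulLeft σ) x

lemma finrank_ker_augmentation : Module.finrank K (LinearMap.ker (augmentation K)) = 5 := by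
  have hsurj : Function.Surjective (augmentation K) := fun a =>
    ⟨Pi.single 1 a, by rw [augmentation_apply, Finset.sum_pi_single']; simp⟩
  have h := (augmentation K).finrank_range_add_finrank_ker
  rw [LinearMap.range_eq_top.2 hsurj, finrank_top, Module.finrank_self,
    Module.finrank_fintype_fun_eq_card] at h
  have hcard : Fintype.card S3 = 6 := by decide
  omega

lemma eq_ker_augmentation {F : Submodule K (GA K)}
    (hinv : ∀ (σ : S3) (x : GA K), x ∈ F → act σ x ∈ F)
    (hdim : Module.finrank K F = 5) (hW : Wv K ∉ F) :
    F = LinearMap.ker (augmentation K) := by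
  refine Submodule.eq_of_le_of_finrank_eq (fun x hx => ?_)
    (hdim.trans finrank_ker_augmentation.symm)
  rw [LinearMap.mem_ker, augmentation_apply]
  by_contra hne
  refine hW ((F.smul_mem_iff hne).1 ?_)
  rw [← sum_act]
  exact F.sum_mem fun σ _ => hinv σ x hx

lemma act_mem_Fv {v x : GA K} (σ : S3) (hx : x ∈ Fv K v) : act σ x ∈ Fv K v := by
  induction hx using Submodule.span_induction with
  | mem x hx =>
    obtain ⟨τ, rfl⟩ := hx
    refine Submodule.subset_span ⟨τ * σ, ?_⟩
    funext ρ
    simp only [act, mul_assoc]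
  | zero => exact (Fv K v).zero_mem
  | add x y _ _ hx hy => exact (Fv K v).add_mem hx hy
  | smul a x _ hx => exact (Fv K v).smul_mem a hx

lemma Fv_le_ker_augmentation {v : GA K} (hv : augmentation K v = 0) :
    Fv K v ≤ LinearMap.ker (augmentation K) := by
  rw [Fv, Submodule.span_le]
  rintro _ ⟨σ, rfl⟩
  exact (augmentation_act σ v).trans hv

lemma sum_smul_act_single_sub (x : GA K) (hx : augmentation K x = 0) (a : K) :
    ∑ ρ, x ρ • act ρ⁻¹ (Pi.single 1 1 - a • Wv K) = x := by
  rw [augmentation_apply] at hx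
  funext τ
  simp [act, Wv_apply, mul_sub, Finset.sum_sub_distrib, ← Finset.sum_mul, hx,
    Pi.single_apply, inv_mul_eq_one]

lemma augmentation_generator : augmentation K (elt 2 (-1) (-1) (-1) 1 0) = 0 := by
  rw [augmentation_apply, sum_S3]
  simp +decide [elt]
  ring

lemma single_sub_mem_Fv [CharZero K] :
    Pi.single 1 1 - (6⁻¹ : K) • Wv K ∈ Fv K (elt 2 (-1) (-1) (-1) 1 0) := by
  have h : Pi.single 1 1 - (6⁻¹ : K) • Wv K =
      ∑ σ, (elt (13 / 36) (-1 / 36) (-1 / 36) (-1 / 36) (1 / 36) (-11 / 36) : GA K) σ •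
        act σ (elt 2 (-1) (-1) (-1) 1 0) := by
    funext τ
    rw [sum_S3]
    rcases S3_cases τ with rfl | rfl | rfl | rfl | rfl | rfl <;>
      simp +decide [act, Wv_apply, elt] <;> norm_num
  rw [h]
  exact Submodule.sum_mem _ fun σ _ =>
    Submodule.smul_mem _ _ (Submodule.subset_span ⟨σ, rfl⟩)

lemma Fv_generator [CharZero K] :
    Fv K (elt 2 (-1) (-1) (-1) 1 0) = LinearMap.ker (augmentation K) := by
  refine le_antisymm (Fv_le_ker_augmentation augmentation_generator) fun x hx => ?_
  rw [← sum_smul_act_single_sub x hx 6⁻¹]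
  exact Submodule.sum_mem _ fun ρ _ =>
    Submodule.smul_mem _ _ (act_mem_Fv ρ⁻¹ single_sub_mem_Fv)

end Augmentation

theorem stmt12 (K : Type*) [Field K] [CharZero K] (F : Submodule K (GA K))
    (hinv : ∀ (σ : S3) (x : GA K), x ∈ F → act σ x ∈ F)
    (hdim : Module.finrank K F = 5) (hW : Wv K ∉ F) :
    (∀ x : GA K, x ∈ F ↔ x 1 + x t12 + x t13 + x t23 + x c1 + x c2 = 0)
    ∧ F = Fv K (elt 2 (-1) (-1) (-1) 1 0) := by
  have hF := eq_ker_augmentation hinv hdim hW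
  refine ⟨fun x => ?_, hF.trans Fv_generator.symm⟩
  rw [hF, LinearMap.mem_ker, augmentation_apply, sum_S3]
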